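/- arXiv:2102.12062 — 8 statements merged into one kernel-verified Lean document; each statement's English description precedes it below -/
import Mathlib

section
/- Let p, q, r ∈ ℂ and let u, ũ, û, ū, ûũ, ũ̄, û̄, t ∈ ℂ satisfy the five equations H2ᵃ(u,ũ,û,ûũ;p,q)=0, Q1₁(u,ũ,ū,ũ̄;p,r)=0, H2ᵃ(u,ū,û,û̄;r,q)=0, Q1₁(û,ûũ,û̄,t;p,r)=0 and H2ᵃ(ũ,ũ̄,ûũ,t;r,q)=0. Assume the nondegeneracy conditions (u−ũ)−p ≠ 0, (u−ū)−r ≠ 0, p(u−ū)−r(u−ũ) ≠ 0 and p(û−û̄)−r(û−ûũ) ≠ 0. Then the sixth (top) equation H2ᵃ(ū,ũ̄,û̄,t;p,q)=0 also holds; i.e. the cube carrying H2ᵃ on bottom and top faces, Q1₁ on two side faces and H2ᵃ on the other two side faces is consistent around the cube, so that Q1₁ together with H2ᵃ furnish an auto-Bäcklund transformation for H2ᵃ. -/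
/-- The torqued H2 polynomial `H2ᵃ(u,x,y,z;p,q)`. -/
def H2a (u x y z p q : ℂ) : ℂ := (u - x) * (z - y) - p * (u + x + y + z + p + 2 * q)

/-- The Q1 polynomial with `δ = 1`. -/
def Q1₁ (u x y z p q : ℂ) : ℂ :=
  p * (u - y) * (x - z) - q * (u - x) * (y - z) + p * q * (p - q)

/-- The cube with `H2ᵃ` on bottom and top, `Q1₁` on two side faces and `H2ᵃ` on the
other two side faces is consistent around the cube: the five equations adjacent to
the bottom-front-left vertex and the top equations on the tilde- and hat-faces,
together with nondegeneracy conditions, imply the top equation. -/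
theorem H2a_Q1₁_consistent_cube
    (p q r u ut uh ub uth utb uhb t : ℂ)
    (hQ : H2a u ut uh uth p q = 0)
    (hA : Q1₁ u ut ub utb p r = 0)
    (hB : H2a u ub uh uhb r q = 0)
    (hA' : Q1₁ uh uth uhb t p r = 0)
    (hB' : H2a ut utb uth t r q = 0)
    (h1 : (u - ut) - p ≠ 0)
    (h2 : (u - ub) - r ≠ 0)
    (h3 : p * (u - ub) - r * (u - ut) ≠ 0)
    (h4 : p * (uh - uhb) - r * (uh - uth) ≠ 0) :
    H2a ub utb uhb t p q = 0 := by
  unfold H2a at *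
  unfold Q1₁ at *
  obtain ⟨α, rfl⟩ : ∃ α, ut = u - p - α := ⟨u - p - ut, by ring⟩
  obtain ⟨β, rfl⟩ : ∃ β, ub = u - r - β := ⟨u - r - ub, by ring⟩
  obtain ⟨S, hS⟩ : ∃ S, S = 2 * u + 2 * uh + 2 * q := ⟨_, rfl⟩
  have hα : α ≠ 0 := fun h => h1 (by rw [h]; ring)
  have hβ : β ≠ 0 := fun h => h2 (by rw [h]; ring)
  have h3' : p * β - r * α ≠ 0 := fun h => h3 (by linear_combination h)
  have e1 : uth = uh + p * (S / α - 1) := by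
    field_simp
    rw [hS]
    linear_combination hQ
  have e2 : uhb = uh + r * (S / β - 1) := by
    field_simp
    rw [hS]
    linear_combination hB
  have e3 : utb = u - (p - r) * (α * β + α * r + β * p) / (p * β - r * α) := by
    field_simp
    linear_combination -hA
  have h4' : p * r * S * (α - β) ≠ 0 := by
    intro h
    apply h4
    rw [e1, e2]
    field_simp
    linear_combination -h
  have hd : α - β ≠ 0 := right_ne_zero_of_mul h4'
  have hpr : p * r * S ≠ 0 := left_ne_zero_of_mul h4'
  have e4 : t = uh + (p - r) * (S - α - β) / (α - β) := by
    rw [e1, e2] at hA'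
    field_simp at hA' ⊢
    apply mul_left_cancel₀ hpr
    linear_combination hA'
  have hq : q = S / 2 - u - uh := by rw [hS]; ring
  rw [e2, e3, e4, hq]
  obtain ⟨D, hD⟩ : ∃ D, D = p * β - r * α := ⟨_, rfl⟩
  rw [← hD] at h3' ⊢
  field_simp
  rw [hD]
  ring
end

section
/- Let p, q, r ∈ ℂ and let u, x, y, z ∈ ℂ satisfy H2ᵃ(u,x,y,z;p,q)=0 (here x, y, z play the roles of the shifts ũ, û, ûũ of u). Define the 2×2 matrices L₀(u,x) := [[−ur−(p−r)x, pux+(p−r)pr], [−p, (p−r)u+rx]] and M₀(u,y) := [[y−r, (y−r)(r−u)−2r(q+u+y)], [1, r−u]]. Then, entrywise (with ∘2 denoting the entrywise square of a matrix and matrix products taken as usual), (p²−(u−x)²)·(q+x+z)·(L₀(y,z)·M₀(u,y))^{∘2} = (p²−(y−z)²)·(q+u+y)·(M₀(x,z)·L₀(u,x))^{∘2}. Equivalently, every entry of the difference of the two entrywise-squared products vanishes on solutions of H2ᵃ, which expresses that the Lax pair L = γL₀, M = γ′M₀ with γ = (p²−(u−x)²)^{−1/2}, γ′ = (q+u+y)^{−1/2}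 is compatible for H2ᵃ. -/
open Matrix

/-- The scalar identity: if `(a+p) N₁ = -(b+p) N₂` with `a = u-x`, `b = z-y`, the entry vanishes. -/
theorem entry_key (p q u x y z N₁ N₂ : ℂ) (hp : p ≠ 0)
    (h : (u - x) * (z - y) - p * (u + x + y + z + p + 2 * q) = 0)
    (hN : (u - x + p) * N₁ + (z - y + p) * N₂ = 0) :
    (p ^ 2 - (u - x) ^ 2) * (q + x + z) * (N₁ * N₁) =
      (p ^ 2 - (y - z) ^ 2) * (q + u + y) * (N₂ * N₂) := by
  have hB : 2 * p * (q + x + z) = (u - x + p) * (z - y - p) := by linear_combination -h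
  have hA : 2 * p * (q + u + y) = (u - x - p) * (z - y + p) := by linear_combination -h
  have h2 : (2 * p) ≠ 0 := mul_ne_zero two_ne_zero hp
  apply mul_left_cancel₀ h2
  linear_combination (p ^ 2 - (u - x) ^ 2) * (N₁ * N₁) * hB
    - (p ^ 2 - (y - z) ^ 2) * (N₂ * N₂) * hA
    - (u - x - p) * (z - y - p) * ((u - x + p) * N₁ - (z - y + p) * N₂) * hN

/-- Compatibility of the Lax pair of `H2ᵃ` (entrywise squares):
on solutions of `H2ᵃ(u,x,y,z;p,q) = 0`, with `L₀`, `M₀` the unnormalized Lax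
matrices, `(p²−(u−x)²)(q+x+z)·(L₀(y,z)M₀(u,y))^{∘2}
= (p²−(y−z)²)(q+u+y)·(M₀(x,z)L₀(u,x))^{∘2}`,
where `∘2` is the Hadamard (entrywise) square. -/
theorem H2a_lax_compatibility_entrywise
    (p q r u x y z : ℂ)
    (h : H2a u x y z p q = 0)
    (L₀ : ℂ → ℂ → Matrix (Fin 2) (Fin 2) ℂ)
    (M₀ : ℂ → ℂ → Matrix (Fin 2) (Fin 2) ℂ)
    (hL : ∀ u x : ℂ, L₀ u x =
      !![-u * r - (p - r) * x, p * u * x + (p - r) * p * r;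
         -p, (p - r) * u + r * x])
    (hM : ∀ u y : ℂ, M₀ u y =
      !![y - r, (y - r) * (r - u) - 2 * r * (q + u + y);
         1, r - u]) :
    ((p ^ 2 - (u - x) ^ 2) * (q + x + z)) •
        Matrix.hadamard (L₀ y z * M₀ u y) (L₀ y z * M₀ u y) =
      ((p ^ 2 - (y - z) ^ 2) * (q + u + y)) •
        Matrix.hadamard (M₀ x z * L₀ u x) (M₀ x z * L₀ u x) := by
  unfold H2a at h
  by_cases hp : p = 0
  · subst hp
    have h0 : (u - x) * (z - y) = 0 := by linear_combination h
    rcases mul_eq_zero.mp h0 with h1 | h1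
    · obtain rfl : u = x := by linear_combination h1
      ext i j
      fin_cases i <;> fin_cases j <;>
        simp [hL, hM, Matrix.mul_apply, Fin.sum_univ_two] <;> ring_nf <;> simp
    · obtain rfl : z = y := by linear_combination h1
      ext i j
      fin_cases i <;> fin_cases j <;>
        simp [hL, hM, Matrix.mul_apply, Fin.sum_univ_two] <;> ring_nf <;> simp
  · ext i j
    simp only [Matrix.smul_apply, Matrix.hadamard_apply, smul_eq_mul]
    apply entry_key p q u x y z _ _ hp h
    fin_cases i <;> fin_cases j <;>
      simp only [hL, hM, Matrix.mul_apply, Fin.sum_univ_two, Fin.zero_eta, Fin.mk_one, Matrix.of_apply,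
        Matrix.cons_val_zero, Matrix.cons_val_one, Matrix.cons_val', Matrix.cons_val_fin_one]
    · linear_combination (-r * (z - y + p)) * h
    · linear_combination r * (r * (z - y) - r * (u - x) - z * (u - x + p) + u * (z - y + p)) * h
    · ring
    · linear_combination (-r * (u - x + p)) * h
end

section
/- Let p, q, r ∈ ℂ and let u, x, y, z ∈ ℂ satisfy H2ᵃ(u,x,y,z;p,q)=0 (here x, y, z play the roles of the shifts ũ, û, ûũ of u). Define the 2×2 matrices L₀(u,x) := [[−ur−(p−r)x, pux+(p−r)pr], [−p, (p−r)u+rx]] and M₀(u,y) := [[y−r, (y−r)(r−u)−2r(q+u+y)], [1, r−u]]. Then, with squares taken as matrix multiplication, (p²−(u−x)²)·(q+x+z)·(L₀(y,z)·M₀(u,y))² = (p²−(y−z)²)·(q+u+y)·(M₀(x,z)·L₀(u,x))². -/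
open Matrix

/-- Compatibility of the Lax pair of `H2ᵃ` (matrix squares):
on solutions of `H2ᵃ(u,x,y,z;p,q) = 0`, with `L₀`, `M₀` the unnormalized Lax
matrices, `(p²−(u−x)²)(q+x+z)·(L₀(y,z)M₀(u,y))²
= (p²−(y−z)²)(q+u+y)·(M₀(x,z)L₀(u,x))²`,
where the square is taken as matrix multiplication. -/
theorem H2a_lax_compatibility_matrix_square
    (p q r u x y z : ℂ)
    (h : H2a u x y z p q = 0)
    (L₀ : ℂ → ℂ → Matrix (Fin 2) (Fin 2) ℂ)
    (M₀ : ℂ → ℂ → Matrix (Fin 2) (Fin 2) ℂ)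
    (hL : ∀ u x : ℂ, L₀ u x =
      !![-u * r - (p - r) * x, p * u * x + (p - r) * p * r;
         -p, (p - r) * u + r * x])
    (hM : ∀ u y : ℂ, M₀ u y =
      !![y - r, (y - r) * (r - u) - 2 * r * (q + u + y);
         1, r - u]) :
    ((p ^ 2 - (u - x) ^ 2) * (q + x + z)) • ((L₀ y z * M₀ u y) ^ 2) =
      ((p ^ 2 - (y - z) ^ 2) * (q + u + y)) • ((M₀ x z * L₀ u x) ^ 2) := by
  unfold H2a at h
  by_cases hp : p = 0
  · subst hp
    have h' : (u - x) * (z - y) = 0 := by linear_combination h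
    rcases mul_eq_zero.mp h' with h1 | h1
    · have hx : u = x := sub_eq_zero.mp h1
      subst hx
      have hz : L₀ u u = 0 := by
        rw [hL]; ext i j; fin_cases i <;> fin_cases j <;> simp <;> ring
      rw [hz]; simp
    · have hy : z = y := sub_eq_zero.mp h1
      subst hy
      have hz : L₀ z z = 0 := by
        rw [hL]; ext i j; fin_cases i <;> fin_cases j <;> simp <;> ring
      rw [hz]; simp
  · have key : (x - u - p) • (L₀ y z * M₀ u y) = (p - y + z) • (M₀ x z * L₀ u x) := by
      rw [hL, hL, hM, hM]
      ext i j
      fin_cases i <;> fin_cases j <;> simp [Matrix.mul_apply, Fin.sum_univ_two]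
      · linear_combination ((p - y + z) * r) * h
      · linear_combination
          (-r * ((x - u - p) * z + (p - y + z) * u + r * (x - u - p + (p - y + z)))) * h
      · ring
      · linear_combination (-(x - u - p) * r) * h
    have key2 : (x - u - p) ^ 2 • (L₀ y z * M₀ u y) ^ 2
        = (p - y + z) ^ 2 • (M₀ x z * L₀ u x) ^ 2 := by
      rw [← smul_pow, ← smul_pow, key]
    have e1 : 2 * p * ((p ^ 2 - (u - x) ^ 2) * (q + x + z))
        = -((p - u + x) * (p + y - z)) * (x - u - p) ^ 2 := by
      linear_combination (-(p ^ 2 - (u - x) ^ 2)) * h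
    have e2 : 2 * p * ((p ^ 2 - (y - z) ^ 2) * (q + u + y))
        = -((p - u + x) * (p + y - z)) * (p - y + z) ^ 2 := by
      linear_combination (-(p ^ 2 - (y - z) ^ 2)) * h
    have h2p : 2 * p ≠ 0 := mul_ne_zero two_ne_zero hp
    apply smul_right_injective _ h2p
    simp only [smul_smul]
    rw [e1, e2, mul_smul, mul_smul, key2]
end

section
/- Let a, c, β, c₀ ∈ ℂ with a ≠ 0 and a² ≠ 1. Set α := −ac/(a²−1), p := α/a, q(m) := (−1)^m β − c/2, and r := c. Then the function u₀ : ℤ² → ℂ given by u₀(n,m) := (−1)^m (αn + βm + c₀) satisfies, for all n, m ∈ ℤ, the fixed-point equations (u₀(n,m) − u₀(n+1,m))² = p(p−r) and u₀(n,m) + u₀(n,m+1) = −q(m) − r/2. -/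
/-- The seed function `u₀(n,m) = (−1)^m (αn + βm + c₀)`, with the parametrisation
`α = −ac/(a²−1)`, `p = α/a`, `q(m) = (−1)^m β − c/2`, `r = c`, satisfies the
fixed-point equations `(u₀ − ũ₀)² = p(p−r)` and `u₀ + û₀ = −q(m) − r/2`. -/
theorem seed_satisfies_fixedPoint_eqs
    (a c β c₀ : ℂ) (ha : a ≠ 0) (ha2 : a ^ 2 ≠ 1)
    (α : ℂ) (hα : α = -(a * c) / (a ^ 2 - 1))
    (p : ℂ) (hp : p = α / a)
    (q : ℤ → ℂ) (hq : ∀ m : ℤ, q m = (-1 : ℂ) ^ m * β - c / 2)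
    (r : ℂ) (hr : r = c)
    (u₀ : ℤ → ℤ → ℂ)
    (hu : ∀ n m : ℤ, u₀ n m = (-1 : ℂ) ^ m * (α * n + β * m + c₀)) :
    ∀ n m : ℤ,
      (u₀ n m - u₀ (n + 1) m) ^ 2 = p * (p - r) ∧
      u₀ n m + u₀ n (m + 1) = -q m - r / 2 := by
  intro n m
  have h1 : a ^ 2 - 1 ≠ 0 := sub_ne_zero.mpr ha2
  have hs : ((-1 : ℂ) ^ m) ^ 2 = 1 := by
    rcases Int.even_or_odd m with h | h
    · rw [h.neg_one_zpow]; norm_num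
    · rw [h.neg_one_zpow]; norm_num
  have hs1 : (-1 : ℂ) ^ (m + 1) = -(-1 : ℂ) ^ m := by
    rw [zpow_add_one₀ (by norm_num)]; ring
  constructor
  · have e1 : (u₀ n m - u₀ (n + 1) m) ^ 2 = α ^ 2 := by
      rw [hu, hu]
      push_cast
      linear_combination α ^ 2 * hs
    rw [e1, hp, hr, hα]
    field_simp
    ring
  · rw [hu, hu, hq, hs1, hr]
    push_cast
    ring
end

section
/- Let a, c, β, c₀ ∈ ℂ with a ≠ 0 and a² ≠ 1. Set α := −ac/(a²−1), p := α/a and q(m) := (−1)^m β − c/2. Then the function u₀ : ℤ² → ℂ given by u₀(n,m) := (−1)^m (αn + βm + c₀) is a (seed) solution of the semi-autonomous torqued H2 equation: for all n, m ∈ ℤ, (u₀(n,m) − u₀(n+1,m))·(u₀(n+1,m+1) − u₀(n,m+1)) − p·(u₀(n,m) + u₀(n+1,m) + u₀(n,m+1) + u₀(n+1,m+1) + p + 2q(m)) = 0. -/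
/-- The seed function `u₀(n,m) = (−1)^m (αn + βm + c₀)`, with the parametrisation
`α = −ac/(a²−1)`, `p = α/a`, `q(m) = (−1)^m β − c/2`, is a solution of the
semi-autonomous torqued H2 equation
`(u−ũ)(ûũ−û) − p(u+ũ+û+ûũ+p+2q(m)) = 0`. -/
theorem seed_solves_H2a
    (a c β c₀ : ℂ) (ha : a ≠ 0) (ha2 : a ^ 2 ≠ 1)
    (α : ℂ) (hα : α = -(a * c) / (a ^ 2 - 1))
    (p : ℂ) (hp : p = α / a)
    (q : ℤ → ℂ) (hq : ∀ m : ℤ, q m = (-1 : ℂ) ^ m * β - c / 2)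
    (u₀ : ℤ → ℤ → ℂ)
    (hu : ∀ n m : ℤ, u₀ n m = (-1 : ℂ) ^ m * (α * n + β * m + c₀)) :
    ∀ n m : ℤ,
      (u₀ n m - u₀ (n + 1) m) * (u₀ (n + 1) (m + 1) - u₀ n (m + 1)) -
        p * (u₀ n m + u₀ (n + 1) m + u₀ n (m + 1) + u₀ (n + 1) (m + 1) + p + 2 * q m)
      = 0 := by
  intro n m
  have h1 : a ^ 2 - 1 ≠ 0 := sub_ne_zero.mpr ha2
  have hαp : α = a * p := by rw [hp]; field_simp
  have hpc : p * (a ^ 2 - 1) = -c := by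
    rw [hp, hα]; field_simp
  have hs : (-1 : ℂ) ^ (m + 1) = -(-1 : ℂ) ^ m := by
    rw [zpow_add_one₀ (by norm_num)]; ring
  have hs2 : (-1 : ℂ) ^ m * (-1 : ℂ) ^ m = 1 := by
    rw [← mul_zpow]; norm_num
  simp only [hu, hq, hs]
  push_cast
  generalize (-1 : ℂ) ^ m = s at hs2
  rw [hαp]
  linear_combination (a * p) ^ 2 * hs2 + p * hpc
end

section
/- Let r, k ∈ ℂ and define F₊(i) := r((−1)^i − k), F₋(i) := r((−1)^i + k) and the matrices N(i) := [[F₊(i), 0], [1, F₋(i)]] for i ∈ ℕ. Then for every integer m ≥ 1, the ordered product N(m−1)·N(m−2)···N(0) equals the matrix [[∏_{i=0}^{m−1} F₊(i), 0], [((1−(−1)^m)/2)·∏_{i=0}^{m−2} F₊(i), ∏_{i=0}^{m−1} F₋(i)]], where for m = 1 the product ∏_{i=0}^{−1} F₊(i) is interpreted as 1. -/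
open Matrix Finset

/-- Explicit "integrated" form of the linearized m-direction Bäcklund recursion:
for `F₊(i) = r((−1)^i − k)`, `F₋(i) = r((−1)^i + k)` and
`N(i) = [[F₊(i), 0], [1, F₋(i)]]`, the ordered product `N(m−1)⋯N(0)` equals
`[[∏_{i<m} F₊(i), 0], [((1−(−1)^m)/2)·∏_{i<m−1} F₊(i), ∏_{i<m} F₋(i)]]`. -/
theorem N_product_formula
    (r k : ℂ)
    (Fp Fm : ℕ → ℂ)
    (hFp : ∀ i, Fp i = r * ((-1 : ℂ) ^ i - k))
    (hFm : ∀ i, Fm i = r * ((-1 : ℂ) ^ i + k))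
    (N : ℕ → Matrix (Fin 2) (Fin 2) ℂ)
    (hN : ∀ i, N i = !![Fp i, 0; 1, Fm i])
    (m : ℕ) (hm : 1 ≤ m) :
    (((List.range m).reverse.map N).prod) =
      !![∏ i ∈ Finset.range m, Fp i, 0;
         ((1 - (-1 : ℂ) ^ m) / 2) * ∏ i ∈ Finset.range (m - 1), Fp i,
         ∏ i ∈ Finset.range m, Fm i] := by
  induction m, hm using Nat.le_induction with
  | base => simp [hN]
  | succ m hm ih =>
    obtain ⟨n, rfl⟩ : ∃ n, m = n + 1 := ⟨m - 1, by omega⟩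
    rw [List.range_succ, List.reverse_append, List.map_append, List.prod_append, ih]
    simp only [List.reverse_singleton, List.map_cons, List.map_nil, List.prod_singleton, hN,
      Nat.add_sub_cancel, Matrix.mul_fin_two]
    rw [Finset.prod_range_succ Fp (n + 1), Finset.prod_range_succ Fm (n + 1),
      Finset.prod_range_succ Fp n, hFp n, hFm (n + 1)]
    generalize ∏ i ∈ Finset.range n, Fp i = P
    generalize ∏ i ∈ Finset.range (n + 1), Fm i = Q
    rw [hFp (n + 1)]
    ext i j
    fin_cases i <;> fin_cases j <;> simp [pow_succ] <;> ring
end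

section
/- Let r, k, a ∈ ℂ and set κ := kr, E₊ := −r(a+k), E₋ := −r(a−k), F₊(m) := r((−1)^m − k), F₋(m) := r((−1)^m + k). Let ρ : ℤ² → ℂ satisfy the recurrences ρ(n+1,m) = ((a+k)/(a−k))·ρ(n,m) and ρ(n,m+1) = (((−1)^m − k)/((−1)^m + k))·ρ(n,m), and assume a ≠ k, a ≠ −k, k ≠ 1, k ≠ −1, and 1 + ρ(n,m) ≠ 0 for all n, m ∈ ℤ. Then the function ν(n,m) := −2κρ(n,m)/(1+ρ(n,m)) satisfies, for all n, m ∈ ℤ, the cross-multiplied Riccati-type recurrences ν(n+1,m)·(ν(n,m) + E₋) = ν(n,m)·E₊ and ν(n,m+1)·(ν(n,m) + F₋(m)) = ν(n,m)·F₊(m). -/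
/-- One step of the recurrence in either direction. -/
theorem riccati_step (r k p d x y P D : ℂ) (hx : 1 + x ≠ 0) (hy : 1 + y ≠ 0)
    (hd : d - p = 2 * k) (h : d * y = p * x) (hP : P = r * p) (hD : D = r * d) :
    -2 * (k * r) * y / (1 + y) * (-2 * (k * r) * x / (1 + x) + D)
      = -2 * (k * r) * x / (1 + x) * P := by
  subst hP hD
  have e : -2 * (k * r) * x / (1 + x) + r * d = r * d * (1 + y) / (1 + x) := by
    field_simp
    linear_combination r * x * hd - r * h
  rw [e]
  have e2 : -2 * (k * r) * y / (1 + y) * (r * d * (1 + y) / (1 + x))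
      = -2 * (k * r) * r * (d * y) / (1 + x) := by
    field_simp
  rw [e2, h]
  ring

/-- The function `ν = −2κρ/(1+ρ)` built from the plane-wave factor `ρ`
satisfies the (cross-multiplied) Riccati-type recurrences
`ν̃(ν+E₋) = νE₊` and `ν̂(ν+F₋(m)) = νF₊(m)`. -/
theorem nu_satisfies_riccati
    (r k a : ℂ)
    (κ : ℂ) (hκ : κ = k * r)
    (Ep Em : ℂ) (hEp : Ep = -r * (a + k)) (hEm : Em = -r * (a - k))
    (Fp Fm : ℤ → ℂ)
    (hFp : ∀ m : ℤ, Fp m = r * ((-1 : ℂ) ^ m - k))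
    (hFm : ∀ m : ℤ, Fm m = r * ((-1 : ℂ) ^ m + k))
    (ρ : ℤ → ℤ → ℂ)
    (hρn : ∀ n m : ℤ, ρ (n + 1) m = ((a + k) / (a - k)) * ρ n m)
    (hρm : ∀ n m : ℤ, ρ n (m + 1) = (((-1 : ℂ) ^ m - k) / ((-1 : ℂ) ^ m + k)) * ρ n m)
    (hak : a ≠ k) (hak' : a ≠ -k) (hk : k ≠ 1) (hk' : k ≠ -1)
    (hρ : ∀ n m : ℤ, 1 + ρ n m ≠ 0)
    (ν : ℤ → ℤ → ℂ)
    (hν : ∀ n m : ℤ, ν n m = -2 * κ * ρ n m / (1 + ρ n m)) :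
    ∀ n m : ℤ,
      ν (n + 1) m * (ν n m + Em) = ν n m * Ep ∧
      ν n (m + 1) * (ν n m + Fm m) = ν n m * Fp m := by
  intro n m
  have h1 : a - k ≠ 0 := sub_ne_zero.mpr hak
  have h2 : (-1 : ℂ) ^ m + k ≠ 0 := by
    rcases Int.even_or_odd m with h | h
    · rw [h.neg_one_zpow]
      intro h0
      exact hk' (by linear_combination h0)
    · rw [h.neg_one_zpow]
      intro h0
      exact hk (by linear_combination h0)
  rw [hν (n + 1) m, hν n (m + 1), hν n m, hFm, hFp, hEp, hEm, hκ]
  constructor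
  · refine riccati_step r k (-(a + k)) (-(a - k)) (ρ n m) _ _ _ (hρ n m) (hρ (n + 1) m)
      (by ring) ?_ (by ring) (by ring)
    rw [hρn]
    field_simp
  · refine riccati_step r k ((-1 : ℂ) ^ m - k) ((-1 : ℂ) ^ m + k) (ρ n m) _ _ _ (hρ n m)
      (hρ n (m + 1)) (by ring) ?_ rfl rfl
    rw [hρm]
    field_simp
end

section
/- Let a, k, c, β, c₀ ∈ ℂ with a ≠ 0, a² ≠ 1, k² ≠ 1 and a ≠ ±k. Set α := −ac/(a²−1), p := α/a and q(m) := (−1)^m β − c/2. Let ρ : ℤ² → ℂ satisfy the plane-wave recurrences ρ(n+1,m) = ((a+k)/(a−k))·ρ(n,m) and ρ(n,m+1) = (((−1)^m−k)/((−1)^m+k))·ρ(n,m), and assume 1 + ρ(n,m) ≠ 0 for all n, m ∈ ℤ. Then the one-soliton function u₁(n,m) := (−1)^m ( αn + βm + c₀ + (ck/(1−k²))·(1−ρ(n,m))/(1+ρ(n,m)) ) solves the semi-autonomous torqued H2 equation: for all n, m ∈ ℤ, (u₁(n,m) − u₁(n+1,m))·(u₁(n+1,m+1) − u₁(n,m+1))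 − p·(u₁(n,m) + u₁(n+1,m) + u₁(n,m+1) + u₁(n+1,m+1) + p + 2q(m)) = 0. -/
/-- The one-soliton function
`u₁(n,m) = (−1)^m (αn + βm + c₀ + (ck/(1−k²))·(1−ρ(n,m))/(1+ρ(n,m)))`
solves the semi-autonomous torqued H2 equation
`(u−ũ)(ûũ−û) − p(u+ũ+û+ûũ+p+2q(m)) = 0`,
where `α = −ac/(a²−1)`, `p = α/a`, `q(m) = (−1)^m β − c/2` and `ρ` is the
plane-wave factor. -/
theorem oneSoliton_solves_H2a
    (a k c β c₀ : ℂ)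
    (ha : a ≠ 0) (ha2 : a ^ 2 ≠ 1) (hk2 : k ^ 2 ≠ 1)
    (hak : a ≠ k) (hak' : a ≠ -k)
    (α : ℂ) (hα : α = -(a * c) / (a ^ 2 - 1))
    (p : ℂ) (hp : p = α / a)
    (q : ℤ → ℂ) (hq : ∀ m : ℤ, q m = (-1 : ℂ) ^ m * β - c / 2)
    (ρ : ℤ → ℤ → ℂ)
    (hρn : ∀ n m : ℤ, ρ (n + 1) m = ((a + k) / (a - k)) * ρ n m)
    (hρm : ∀ n m : ℤ, ρ n (m + 1) = (((-1 : ℂ) ^ m - k) / ((-1 : ℂ) ^ m + k)) * ρ n m)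
    (hρ : ∀ n m : ℤ, 1 + ρ n m ≠ 0)
    (u₁ : ℤ → ℤ → ℂ)
    (hu₁ : ∀ n m : ℤ, u₁ n m = (-1 : ℂ) ^ m *
      (α * n + β * m + c₀ + (c * k / (1 - k ^ 2)) * (1 - ρ n m) / (1 + ρ n m))) :
    ∀ n m : ℤ,
      (u₁ n m - u₁ (n + 1) m) * (u₁ (n + 1) (m + 1) - u₁ n (m + 1)) -
        p * (u₁ n m + u₁ (n + 1) m + u₁ n (m + 1) + u₁ (n + 1) (m + 1) + p + 2 * q m)
      = 0 := by
  intro n m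
  have e1 := hρn n m
  have e2 := hρm n m
  have e12 := hρn n (m + 1)
  have d0 := hρ n m
  have d1 := hρ (n + 1) m
  have d2 := hρ n (m + 1)
  have d12 := hρ (n + 1) (m + 1)
  have hs : (-1 : ℂ) ^ (m + 1) = -(-1 : ℂ) ^ m := by
    rw [zpow_add₀ (by norm_num)]; simp
  have hs1 : (-1 : ℂ) ^ m = 1 ∨ (-1 : ℂ) ^ m = -1 := by
    rcases Int.even_or_odd m with h | h
    · left; exact h.neg_one_zpow
    · right; exact h.neg_one_zpow
  rw [hu₁, hu₁, hu₁, hu₁, hq, hs]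
  push_cast
  rw [e12] at d12 ⊢
  rw [e2] at d2 d12 ⊢
  rw [e1] at d1 ⊢
  generalize ρ n m = r at *
  have hA : a - k ≠ 0 := sub_ne_zero.mpr hak
  have hB : a ^ 2 - 1 ≠ 0 := sub_ne_zero.mpr ha2
  have hK : 1 - k ^ 2 ≠ 0 := sub_ne_zero.mpr (Ne.symm hk2)
  have hKp : 1 + k ≠ 0 := fun h => hK (by linear_combination (1 - k) * h)
  have hKm : 1 - k ≠ 0 := fun h => hK (by linear_combination (1 + k) * h)
  -- Möbius form of the soliton factor
  have key : ∀ x y z : ℂ, y ≠ 0 → 1 + x / y * z ≠ 0 →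
      y + x * z ≠ 0 ∧ (1 - x / y * z) / (1 + x / y * z) = (y - x * z) / (y + x * z) := by
    intro x y z hy h
    have h' : y + x * z ≠ 0 := by
      intro h0; apply h; field_simp; simpa using h0
    refine ⟨h', ?_⟩
    field_simp
  have hσ : (-1 : ℂ) ^ m + k ≠ 0 := by
    rcases hs1 with h | h <;> rw [h]
    · exact hKp
    · intro h0; apply hKm; linear_combination -h0
  have hsq : ((-1 : ℂ) ^ m) ^ 2 = 1 := by rcases hs1 with h | h <;> rw [h] <;> norm_num
  generalize (-1 : ℂ) ^ m = s at *
  have r12 : (a + k) / (a - k) * ((s - k) / (s + k) * r)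
      = ((a + k) * (s - k)) / ((a - k) * (s + k)) * r := by
    field_simp
  rw [r12] at d12 ⊢
  obtain ⟨f1, g1⟩ := key _ _ _ hA d1
  obtain ⟨f2, g2⟩ := key _ _ _ hσ d2
  obtain ⟨f12, g12⟩ := key _ _ _ (mul_ne_zero hA hσ) d12
  simp only [mul_div_assoc] at g1 g2 g12 ⊢
  simp only [g1, g2, g12]
  subst hp hα
  clear g1 g2 g12 r12 d1 d2 d12 key hu₁ hq hρn hρm hρ e1 e2 e12 hak hak' ha2 hk2
  obtain ⟨D0, h0⟩ : ∃ D, D = 1 + r := ⟨_, rfl⟩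
  obtain ⟨D1, h1⟩ : ∃ D, D = a - k + (a + k) * r := ⟨_, rfl⟩
  obtain ⟨D2, h2⟩ : ∃ D, D = s + k + (s - k) * r := ⟨_, rfl⟩
  obtain ⟨D3, h3⟩ : ∃ D, D = (a - k) * (s + k) + (a + k) * (s - k) * r := ⟨_, rfl⟩
  obtain ⟨B, hB'⟩ : ∃ D, D = a ^ 2 - 1 := ⟨_, rfl⟩
  obtain ⟨K, hK'⟩ : ∃ D, D = 1 - k ^ 2 := ⟨_, rfl⟩
  rw [← h0] at d0 ⊢
  rw [← h1] at f1 ⊢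
  rw [← h2] at f2 ⊢
  rw [← h3] at f12 ⊢
  rw [← hB'] at hB ⊢
  rw [← hK'] at hK ⊢
  have E1 : (a - k - (a + k) * r) / D1 - (1 - r) / D0 = -4 * k * r / (D0 * D1) := by
    field_simp; rw [h0, h1]; ring
  have E2 : ((a - k) * (s + k) - (a + k) * (s - k) * r) / D3 - (s + k - (s - k) * r) / D2
      = -4 * k * K * r / (D2 * D3) := by
    field_simp; rw [h2, h3, hK']; linear_combination (-4 * k * r) * hsq
  have E3 : (1 - r) / D0 - ((a - k) * (s + k) - (a + k) * (s - k) * r) / D3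
      = (4 * k * r * (s - a)) / (D0 * D3) := by
    field_simp; rw [h0, h3]; ring
  have E4 : (a - k - (a + k) * r) / D1 - (s + k - (s - k) * r) / D2
      = (-4 * k * r * (a + s)) / (D1 * D2) := by
    field_simp; rw [h1, h2]; ring
  have F : (-(a * c) / B + c * k / K * (-4 * k * r / (D0 * D1))) *
      (-(a * c) / B + c * k / K * (-4 * k * K * r / (D2 * D3)))
      + c / B * (s * (c * k / K) * ((4 * k * r * (s - a)) / (D0 * D3)
        + (-4 * k * r * (a + s)) / (D1 * D2)) - c / B - c) = 0 := by
    field_simp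
    rcases hs1 with h | h <;> subst h <;> rw [h0, h1, h2, h3, hB', hK'] <;> ring
  have hp' : -(a * c) / B / a = -c / B := by field_simp
  rw [hp']
  rw [← E1, ← E2, ← E3, ← E4] at F
  generalize (1 - r) / D0 = X0 at F ⊢
  generalize (a - k - (a + k) * r) / D1 = X1 at F ⊢
  generalize (s + k - (s - k) * r) / D2 = X2 at F ⊢
  generalize ((a - k) * (s + k) - (a + k) * (s - k) * r) / D3 = X3 at F ⊢
  linear_combination F + ((-(a * c) / B + c * k / K * (X1 - X0)) *
      (-(a * c) / B + c * k / K * (X3 - X2))) * hsq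
end
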